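/- arXiv:2603.21449 — 2 statements merged into one kernel-verified Lean document; each statement's English description precedes it below -/
import Mathlib

section
/- Let 𝒢 = (G, L) be a labeled graph over a finite alphabet Σ with W_n(G) ≠ ∅ for all n. Let H be the graph with a single vertex v_0 and edge set Σ, where each edge is a self-loop at v_0, and define P : E_G × Σ → ℤ by P(e,a) = 0 if L(e) = a and P(e,a) = 1 otherwise. Then for every n ∈ ℕ, R(C_n(𝒢)) = V_n(G, H, P), where C_n(𝒢) ⊆ Σ^n is the set of label sequences L(p) of length-n walks p in G. -/
open Filter Set

structure DirGraph (V E : Type) where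
  src : E → V
  tgt : E → V

namespace DirGraph

variable {V E : Type}

/-- A (finite) walk: consecutive edges are compatible. -/
def IsWalkList (G : DirGraph V E) (p : List E) : Prop :=
  p.Chain' fun e f => G.tgt e = G.src f

/-- The set of walks of length `n`. -/
def walks (G : DirGraph V E) (n : ℕ) : Set (List E) :=
  {p | p.length = n ∧ G.IsWalkList p}

/-- The set of walks of length `n` from `v` to `w`. -/
def walksFT (G : DirGraph V E) (n : ℕ) (v w : V) : Set (List E) :=
  {p | p.length = n ∧ G.IsWalkList p ∧
    ∃ h : p ≠ [], G.src (p.head h) = v ∧ G.tgt (p.getLast h) = w}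

def IsCycle (G : DirGraph V E) (p : List E) : Prop :=
  G.IsWalkList p ∧ ∃ h : p ≠ [], G.src (p.head h) = G.tgt (p.getLast h)

def Irreducible (G : DirGraph V E) : Prop :=
  ∀ v w : V, ∃ n : ℕ, (G.walksFT n v w).Nonempty

/-- Irreducible and the gcd of all cycle lengths is 1 (every common divisor of
the cycle lengths equals 1). -/
def Primitive (G : DirGraph V E) : Prop :=
  G.Irreducible ∧ ∀ d : ℕ, (∀ p, G.IsCycle p → d ∣ p.length) → d = 1

end DirGraph

/-- `Σ_i P(q_i, p_i)`. -/
def payoffSum {EG EH : Type} (P : EG → EH → ℤ) (q : List EG) (p : List EH) : ℤ :=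
  (List.zipWith P q p).sum

/-- `V_n(G,H,P) = max_{p ∈ W_n(H)} min_{q ∈ W_n(G)} Σ P(q_i,p_i)`. -/
noncomputable def Vn {VG EG VH EH : Type} (G : DirGraph VG EG) (H : DirGraph VH EH)
    (P : EG → EH → ℤ) (n : ℕ) : ℤ :=
  sSup ((fun p => sInf ((fun q => payoffSum P q p) '' G.walks n)) '' H.walks n)

/-- `M(p)(v,w) = inf {Σ P(q_i,p_i) : q ∈ W_n(G, v → w)}`, with `inf ∅ = ⊤`. -/
noncomputable def Mfun {VG EG EH : Type} (G : DirGraph VG EG) (P : EG → EH → ℤ)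
    (p : List EH) : VG → VG → WithTop ℤ :=
  fun v w => sInf ((fun q => ((payoffSum P q p : ℤ) : WithTop ℤ)) '' G.walksFT p.length v w)

/-- `f < g` pointwise everywhere. -/
def StrictDom {V α : Type} [LT α] (f g : V → V → α) : Prop := ∀ v w, f v w < g v w

/-- `<`-maximal elements of a set w.r.t. a strict domination relation. -/
def maxElems {α : Type} (lt : α → α → Prop) (A : Set α) : Set α :=
  {f ∈ A | ¬ ∃ g ∈ A, lt f g}

/-- Tropical convolution on `(ℤ ∪ {∞})`-valued matrices. -/
noncomputable def tconv {V : Type} (f g : V → V → WithTop ℤ) : V → V → WithTop ℤ :=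
  fun u w => sInf (Set.range fun v => f u v + g v w)

/-- Tropical convolution on `ℤ`-valued matrices. -/
noncomputable def tconvZ {V : Type} (f g : V → V → ℤ) : V → V → ℤ :=
  fun u w => sInf (Set.range fun v => f u v + g v w)

/-- Non-improvable walks in `H` (of any length). -/
noncomputable def walksDagger {VG EG VH EH : Type} (G : DirGraph VG EG) (H : DirGraph VH EH)
    (P : EG → EH → ℤ) : Set (List EH) :=
  {p | ∃ u v : VH, p ∈ H.walksFT p.length u v ∧
    Mfun G P p ∈ maxElems StrictDom (Mfun G P '' H.walksFT p.length u v)}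

/-- The edge shift of a graph. -/
def XEdge {V E : Type} (G : DirGraph V E) : Set (ℤ → E) :=
  {x | ∀ n : ℤ, G.tgt (x n) = G.src (x (n + 1))}

/-- The word `x_{[m,n]}` as a list (of length `n - m + 1` when `m ≤ n`). -/
def seg {A : Type} (x : ℤ → A) (m n : ℤ) : List A :=
  List.ofFn fun i : Fin (n + 1 - m).toNat => x (m + i)

/-- `X_H^†`: points all of whose subwords are non-improvable walks. -/
noncomputable def XHdag {VG EG VH EH : Type} (G : DirGraph VG EG) (H : DirGraph VH EH)
    (P : EG → EH → ℤ) : Set (ℤ → EH) :=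
  {x | x ∈ XEdge H ∧ ∀ m n : ℤ, m ≤ n → seg x m n ∈ walksDagger G H P}

/-- `R(p)`: optimal responses to `p`. -/
noncomputable def Rset {VG EG EH : Type} (G : DirGraph VG EG) (P : EG → EH → ℤ)
    (p : List EH) : Set (List EG) :=
  {q | ∃ v w : VG, q ∈ G.walksFT p.length v w ∧
    ((payoffSum P q p : ℤ) : WithTop ℤ) = Mfun G P p v w}

/-- `C_n(𝒢)`: the label words of length-`n` walks of `G`. -/
def labelWords {V E A : Type} (G : DirGraph V E) (L : E → A) (n : ℕ) :
    Set (Fin n → A) :=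
  {w | ∃ p ∈ G.walks n, p.map L = List.ofFn w}

/-- The covering radius of a code `C ⊆ Σ^n`. -/
noncomputable def coveringRadius {A : Type} [Fintype A] [DecidableEq A] {n : ℕ}
    (C : Set (Fin n → A)) : ℕ :=
  ⨆ v : Fin n → A, ⨅ w : C, hammingDist v (w : Fin n → A)

/-- The graph with a single vertex and one self-loop per symbol of `A`. -/
def fullLoopGraph (A : Type) : DirGraph Unit A :=
  ⟨fun _ => (), fun _ => ()⟩

theorem payoffSum_ofFn_eq_hammingDist {E A : Type} [DecidableEq A] (L : E → A) {n : ℕ}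
    (v w : Fin n → A) (q : List E) (hq : q.map L = List.ofFn w) :
    payoffSum (fun e a => if L e = a then 0 else 1) q (List.ofFn v) = (hammingDist v w : ℤ) := by
  induction n generalizing q with
  | zero => simp [payoffSum, hammingDist]
  | succ n ih =>
    rw [List.ofFn_succ] at hq
    obtain ⟨e, q, rfl, he, htail⟩ := List.map_eq_cons_iff.mp hq
    have hsum := ih (fun i => v i.succ) (fun i => w i.succ) q htail
    simp only [payoffSum, hammingDist, Finset.card_filter] at hsum ⊢
    rw [Fin.sum_univ_succ, List.ofFn_succ, List.zipWith_cons_cons, List.sum_cons, hsum, he]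
    by_cases h : w 0 = v 0 <;> simp [h, eq_comm (a := v 0)]

theorem ofFn_mem_walks_fullLoopGraph {A : Type} {n : ℕ} (v : Fin n → A) :
    List.ofFn v ∈ (fullLoopGraph A).walks n :=
  ⟨List.length_ofFn, List.isChain_iff_getElem.mpr fun _ _ => rfl⟩

theorem walks_fullLoopGraph (A : Type) (n : ℕ) :
    (fullLoopGraph A).walks n = Set.range (List.ofFn : (Fin n → A) → List A) := by
  ext p
  constructor
  · rintro ⟨rfl, -⟩
    exact ⟨p.get, List.ofFn_get p⟩
  · rintro ⟨v, rfl⟩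
    exact ofFn_mem_walks_fullLoopGraph v

theorem exists_mem_labelWords {V E A : Type} {G : DirGraph V E} (L : E → A) {n : ℕ}
    {q : List E} (hq : q ∈ G.walks n) :
    ∃ w ∈ labelWords G L n, q.map L = List.ofFn w := by
  obtain ⟨rfl, -⟩ := id hq
  have hw : q.map L = List.ofFn fun i => L (q.get i) := by
    conv_lhs => rw [← List.ofFn_get q]
    rw [List.map_ofFn]
    rfl
  exact ⟨_, ⟨q, hq, hw⟩, hw⟩

theorem sInf_payoffSum_eq_iInf_hammingDist {V E A : Type} [DecidableEq A] (G : DirGraph V E)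
    (L : E → A) {n : ℕ} (hne : (G.walks n).Nonempty) (v : Fin n → A) :
    sInf ((fun q => payoffSum (fun e a => if L e = a then 0 else 1) q (List.ofFn v)) ''
        G.walks n) =
      ((⨅ w : labelWords G L n, hammingDist v (w : Fin n → A) : ℕ) : ℤ) := by
  obtain ⟨q₀, hq₀⟩ := hne
  obtain ⟨w₀, hw₀, -⟩ := exists_mem_labelWords L hq₀
  have : Nonempty (labelWords G L n) := ⟨⟨w₀, hw₀⟩⟩
  refine IsLeast.csInf_eq ⟨?_, ?_⟩
  · obtain ⟨⟨w, q, hq, hqw⟩, hmin⟩ :=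
      Nat.sInf_mem (Set.range_nonempty fun w : labelWords G L n => hammingDist v (w : Fin n → A))
    exact ⟨q, hq, (payoffSum_ofFn_eq_hammingDist L v w q hqw).trans (congrArg Nat.cast hmin)⟩
  · rintro _ ⟨q, hq, rfl⟩
    obtain ⟨w, hw, hqw⟩ := exists_mem_labelWords L hq
    simp only [payoffSum_ofFn_eq_hammingDist L v w q hqw]
    exact_mod_cast ciInf_le' (fun w : labelWords G L n => hammingDist v (w : Fin n → A)) ⟨w, hw⟩

/-- With `H` the single-vertex graph over `Σ` and `P(e,a) = 0` iff `L(e) = a` (else `1`),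
`R(C_n(𝒢)) = V_n(G,H,P)` for every `n`. -/
theorem covering_radius_eq_game_value {V E A : Type} [Fintype V] [Fintype E]
    [Fintype A] [DecidableEq A] (G : DirGraph V E) (L : E → A)
    (hne : ∀ n : ℕ, (G.walks n).Nonempty) :
    ∀ n : ℕ, (coveringRadius (labelWords G L n) : ℤ)
      = Vn G (fullLoopGraph A) (fun e a => if L e = a then 0 else 1) n := by
  intro n
  obtain ⟨q, hq⟩ := hne n
  obtain ⟨w, -, -⟩ := exists_mem_labelWords L hq
  have : Nonempty (Fin n → A) := ⟨w⟩
  rw [Vn, walks_fullLoopGraph, ← Set.range_comp]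
  simp only [Function.comp_def, sInf_payoffSum_eq_iInf_hammingDist G L (hne n)]
  refine (IsGreatest.csSup_eq ⟨?_, ?_⟩).symm
  · obtain ⟨v, hv⟩ := exists_eq_ciSup_of_finite
      (f := fun v : Fin n → A => ⨅ w : labelWords G L n, hammingDist v (w : Fin n → A))
    exact ⟨v, congrArg Nat.cast hv⟩
  · rintro _ ⟨v, rfl⟩
    exact Nat.cast_le.mpr (le_ciSup (Set.finite_range fun v : Fin n → A =>
      ⨅ w : labelWords G L n, hammingDist v (w : Fin n → A)).bddAbove v)
end

section
/- Let G, H be graphs with nonempty edge shifts X_G and X_H, and let P : E_G × E_H → ℤ be a payoff function. Then X_H† ≠ ∅ and Y†_{(H,G)} ≠ ∅; moreover, for every x ∈ X_H† there exists y ∈ X_G such that (x,y) ∈ Y†_{(H,G)}. -/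
open Filter Set

/-- `Y†_{(H,G)}`. -/
noncomputable def Ydag {VG EG VH EH : Type} (G : DirGraph VG EG) (H : DirGraph VH EH)
    (P : EG → EH → ℤ) : Set ((ℤ → EH) × (ℤ → EG)) :=
  {xy | xy.1 ∈ XHdag G H P ∧ xy.2 ∈ XEdge G ∧
    ∀ m n : ℤ, m ≤ n → seg xy.2 m n ∈ Rset G P (seg xy.1 m n)}

namespace DirGraph

variable {V E : Type}

/-- `G.Joins v p w`: the possibly empty list of edges `p` is a walk from `v` to `w`. -/
def Joins (G : DirGraph V E) : V → List E → V → Prop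
  | v, [], w => v = w
  | v, e :: p, w => G.src e = v ∧ G.Joins (G.tgt e) p w

theorem joins_append {G : DirGraph V E} {a b : List E} {v w : V} :
    G.Joins v (a ++ b) w ↔ ∃ u, G.Joins v a u ∧ G.Joins u b w := by
  induction a generalizing v with
  | nil => simp [Joins]
  | cons e a ih => simp [Joins, ih, and_assoc]

theorem isWalkList_iff_isChain {G : DirGraph V E} {p : List E} :
    G.IsWalkList p ↔ p.IsChain fun e f => G.tgt e = G.src f :=
  Iff.rfl

theorem joins_cons_iff {G : DirGraph V E} {e : E} {p : List E} {v w : V} :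
    G.Joins v (e :: p) w ↔
      G.IsWalkList (e :: p) ∧ G.src e = v ∧ G.tgt ((e :: p).getLast (by simp)) = w := by
  induction p generalizing e v with
  | nil => simp [Joins, isWalkList_iff_isChain]
  | cons f p ih =>
    rw [Joins, ih]
    simp only [isWalkList_iff_isChain, List.isChain_cons_cons, List.getLast_cons_cons]
    grind

theorem mem_walksFT_iff {G : DirGraph V E} {n : ℕ} {p : List E} {v w : V} :
    p ∈ G.walksFT n v w ↔ p.length = n ∧ p ≠ [] ∧ G.Joins v p w := by
  cases p with
  | nil => simp [walksFT]
  | cons e p => simp [walksFT, joins_cons_iff]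

theorem finite_walksFT [Finite E] (G : DirGraph V E) (n : ℕ) (v w : V) :
    (G.walksFT n v w).Finite :=
  (List.finite_length_eq E n).subset fun _ hp => hp.1

theorem walksFT_nonempty_of_le {G : DirGraph V E} {k n : ℕ} (hkn : k ≤ n)
    (h : ∀ v w, (G.walksFT k v w).Nonempty) (v w : V) : (G.walksFT n v w).Nonempty := by
  induction n, hkn using Nat.le_induction generalizing v with
  | base => exact h v w
  | succ n _ ih =>
    obtain ⟨p, hp⟩ := h v w
    rw [mem_walksFT_iff] at hp
    obtain ⟨-, hne, hp⟩ := hp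
    cases p with
    | nil => exact absurd rfl hne
    | cons e p =>
      obtain ⟨q, hq⟩ := ih (G.tgt e)
      rw [mem_walksFT_iff] at hq
      exact ⟨e :: q, mem_walksFT_iff.2 ⟨by simp [hq.1], by simp, hp.1, hq.2.2⟩⟩

end DirGraph

open DirGraph

theorem List.exists_eq_append_of_length_eq_add {A : Type} {q : List A} {i j k : ℕ}
    (h : q.length = i + j + k) :
    ∃ a b c, q = a ++ b ++ c ∧ a.length = i ∧ b.length = j ∧ c.length = k :=
  ⟨q.take i, (q.drop i).take j, (q.drop i).drop j, by simp, by simp; omega, by simp; omega,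
    by simp; omega⟩

section Seg

variable {A : Type} {x : ℤ → A} {m n : ℤ}

theorem length_seg (x : ℤ → A) (m n : ℤ) : (seg x m n).length = (n + 1 - m).toNat := by
  simp [seg]

theorem seg_ne_nil (x : ℤ → A) (h : m ≤ n) : seg x m n ≠ [] := by
  rw [← List.length_pos_iff, length_seg]
  omega

theorem seg_append (x : ℤ → A) {k l : ℤ} (hmk : m ≤ k) (hkl : k ≤ l + 1) (hln : l ≤ n) :
    seg x m n = seg x m (k - 1) ++ seg x k l ++ seg x (l + 1) n := by
  apply List.ext_getElem
  · simp only [length_seg, List.length_append]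
    omega
  · intro i h₁ h₂
    simp only [seg, List.getElem_append, List.getElem_ofFn, List.length_append, List.length_ofFn]
    split_ifs <;> congr 1 <;> omega

theorem seg_pair (x : ℤ → A) (n : ℤ) : seg x n (n + 1) = [x n, x (n + 1)] := by
  apply List.ext_getElem
  · simp only [length_seg, List.length_cons, List.length_nil]
    omega
  · intro i h₁ h₂
    simp only [List.length_cons, List.length_nil] at h₂
    interval_cases i <;> simp [seg]

theorem exists_seg_eq {p : List A} (hp : p ≠ []) (hlen : p.length = (n + 1 - m).toNat) :
    ∃ x, seg x m n = p := by
  refine ⟨fun i => p.getD (i - m).toNat (p.head hp), List.ext_getElem ?_ fun i h₁ h₂ => ?_⟩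
  · rw [length_seg, hlen]
  · simp [seg, h₂]

theorem isClosed_setOf_seg_mem [TopologicalSpace A] [DiscreteTopology A] (m n : ℤ)
    (S : Set (List A)) : IsClosed {x : ℤ → A | seg x m n ∈ S} := by
  have h : Continuous fun (x : ℤ → A) (i : Fin (n + 1 - m).toNat) => x (m + i) := by fun_prop
  exact (isClosed_discrete {f : Fin (n + 1 - m).toNat → A | List.ofFn f ∈ S}).preimage h

/-- If `S m n` is a family of sets of words closed under restriction to subintervals, and every
`S (-N) N` contains a word of the right length, then some bi-infinite sequence has all its
subwords in the sets `S m n`. -/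
theorem exists_forall_seg_mem [Finite A] (S : ℤ → ℤ → Set (List A))
    (hsub : ∀ (x : ℤ → A) (m k l n : ℤ), m ≤ k → k ≤ l → l ≤ n →
      seg x m n ∈ S m n → seg x k l ∈ S k l)
    (hne : ∀ N : ℕ, ∃ x : ℤ → A, seg x (-N) N ∈ S (-N) N) :
    ∃ x : ℤ → A, ∀ m n, m ≤ n → seg x m n ∈ S m n := by
  let : TopologicalSpace A := ⊥
  have : DiscreteTopology A := ⟨rfl⟩
  obtain ⟨x, hx⟩ := IsCompact.nonempty_iInter_of_sequence_nonempty_isCompact_isClosed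
    (fun N : ℕ => {x : ℤ → A | seg x (-N) N ∈ S (-N) N})
    (fun N x hx => hsub x _ _ _ _ (by push_cast; omega) (by omega) (by push_cast; omega) hx)
    hne (isClosed_setOf_seg_mem _ _ _).isCompact (fun N => isClosed_setOf_seg_mem _ _ _)
  rw [mem_iInter] at hx
  refine ⟨x, fun m n hmn => ?_⟩
  exact hsub x (-(max m.natAbs n.natAbs : ℕ)) m n (max m.natAbs n.natAbs : ℕ) (by omega) hmn
    (by omega) (hx (max m.natAbs n.natAbs))

end Seg

theorem exists_joins_seg {V E : Type} {G : DirGraph V E} {y : ℤ → E} (hy : y ∈ XEdge G)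
    (m n : ℤ) : ∃ v w, G.Joins v (seg y m n) w := by
  have key : ∀ (k : ℕ) (m : ℤ), ∃ w, G.Joins (G.src (y m))
      (List.ofFn fun i : Fin k => y (m + i)) w := by
    intro k
    induction k with
    | zero => simp [Joins]
    | succ k ih =>
      intro m
      obtain ⟨w, hw⟩ := ih (m + 1)
      refine ⟨w, ?_⟩
      rw [List.ofFn_succ]
      refine ⟨by simp, ?_⟩
      convert hw using 3
      · simp [hy m]
      · push_cast [Fin.val_succ]
        ring_nf
  exact ⟨_, key _ m⟩

theorem mem_XEdge_of_joins_seg {V E : Type} {G : DirGraph V E} {y : ℤ → E}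
    (h : ∀ n, ∃ v w, G.Joins v (seg y n (n + 1)) w) : y ∈ XEdge G := by
  intro n
  obtain ⟨v, w, h⟩ := h n
  rw [seg_pair] at h
  exact h.2.1.symm

theorem payoffSum_append {EG EH : Type} (P : EG → EH → ℤ) {q q' : List EG} {p p' : List EH}
    (h : q.length = p.length) :
    payoffSum P (q ++ q') (p ++ p') = payoffSum P q p + payoffSum P q' p' := by
  simp [payoffSum, List.zipWith_append h]

theorem walksFT_nonempty_of_Mfun_lt_top {VG EG EH : Type} {G : DirGraph VG EG} {P : EG → EH → ℤ}
    {p : List EH} {v w : VG}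
    (h : Mfun G P p v w < ⊤) : (G.walksFT p.length v w).Nonempty := by
  by_contra hne
  rw [not_nonempty_iff_eq_empty] at hne
  simp [Mfun, hne, WithTop.sInf_empty] at h

section Payoff

variable {VG EG VH EH : Type} [Finite EG] {G : DirGraph VG EG} {H : DirGraph VH EH}
  {P : EG → EH → ℤ}

theorem Mfun_le {p : List EH} {q : List EG} {v w : VG} (hq : q ∈ G.walksFT p.length v w) :
    Mfun G P p v w ≤ (payoffSum P q p : ℤ) :=
  csInf_le ((G.finite_walksFT _ v w).image _).bddBelow (mem_image_of_mem _ hq)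

theorem exists_payoffSum_eq_Mfun {p : List EH} {v w : VG}
    (h : (G.walksFT p.length v w).Nonempty) :
    ∃ q ∈ G.walksFT p.length v w, ((payoffSum P q p : ℤ) : WithTop ℤ) = Mfun G P p v w :=
  (h.image _).csInf_mem ((G.finite_walksFT _ v w).image _)

/-- A segment of an optimal response is an optimal response to the matching segment. -/
theorem mem_Rset_of_append {a b c : List EH} {qa qb qc : List EG}
    (ha : qa.length = a.length) (hb : qb.length = b.length) (hne : qb ≠ [])
    (h : qa ++ qb ++ qc ∈ Rset G P (a ++ b ++ c)) : qb ∈ Rset G P b := by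
  obtain ⟨v, w, hq, hmin⟩ := h
  obtain ⟨hlen, -, hj⟩ := mem_walksFT_iff.1 hq
  obtain ⟨t, hj, hjc⟩ := joins_append.1 hj
  obtain ⟨s, hja, hjb⟩ := joins_append.1 hj
  have hmem : qb ∈ G.walksFT b.length s t := mem_walksFT_iff.2 ⟨hb, hne, hjb⟩
  refine ⟨s, t, hmem, le_antisymm ?_ (Mfun_le hmem)⟩
  obtain ⟨r, hr, hrM⟩ := exists_payoffSum_eq_Mfun (P := P) ⟨qb, hmem⟩
  obtain ⟨hrlen, hrne, hjr⟩ := mem_walksFT_iff.1 hr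
  have hle : Mfun G P (a ++ b ++ c) v w ≤ (payoffSum P (qa ++ r ++ qc) (a ++ b ++ c) : ℤ) :=
    Mfun_le (mem_walksFT_iff.2 ⟨by simp at hlen ⊢; omega, by simp [hrne],
      joins_append.2 ⟨t, joins_append.2 ⟨s, hja, hjr⟩, hjc⟩⟩)
  rw [← hmin, WithTop.coe_le_coe, payoffSum_append P (by simp; omega), payoffSum_append P ha,
    payoffSum_append P (by simp; omega), payoffSum_append P ha] at hle
  rw [← hrM, WithTop.coe_le_coe]
  omega

/-- Replacing a segment by a dominating one yields a dominating walk. -/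
theorem strictDom_append {a b b' c : List EH} (hlen : b'.length = b.length)
    (h : StrictDom (Mfun G P b) (Mfun G P b')) :
    StrictDom (Mfun G P (a ++ b ++ c)) (Mfun G P (a ++ b' ++ c)) := by
  intro v w
  have hwalks : (G.walksFT (a ++ b' ++ c).length v w).Nonempty :=
    walksFT_nonempty_of_le (k := b.length) (by simp; omega)
      (fun s t => walksFT_nonempty_of_Mfun_lt_top ((h s t).trans_le le_top)) v w
  obtain ⟨q, hq, hqM⟩ := exists_payoffSum_eq_Mfun (P := P) hwalks
  obtain ⟨hqlen, -, hj⟩ := mem_walksFT_iff.1 hq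
  obtain ⟨qa, qb, qc, rfl, hqa, hqb, hqc⟩ :=
    List.exists_eq_append_of_length_eq_add
      (hqlen.trans (by rw [List.length_append, List.length_append]))
  obtain ⟨t, hj, hjc⟩ := joins_append.1 hj
  obtain ⟨s, hja, hjb⟩ := joins_append.1 hj
  obtain ⟨r, hr, hrM⟩ := exists_payoffSum_eq_Mfun (P := P)
    (walksFT_nonempty_of_Mfun_lt_top ((h s t).trans_le le_top))
  obtain ⟨hrlen, hrne, hjr⟩ := mem_walksFT_iff.1 hr
  have hqb_ne : qb ≠ [] := by
    rw [← List.length_pos_iff] at hrne ⊢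
    omega
  have hlt : payoffSum P r b < payoffSum P qb b' := by
    rw [← WithTop.coe_lt_coe, hrM]
    exact (h s t).trans_le (Mfun_le (mem_walksFT_iff.2 ⟨hqb, hqb_ne, hjb⟩))
  calc Mfun G P (a ++ b ++ c) v w
      ≤ (payoffSum P (qa ++ r ++ qc) (a ++ b ++ c) : ℤ) :=
        Mfun_le (mem_walksFT_iff.2 ⟨by simp; omega, by simp [hrne],
          joins_append.2 ⟨t, joins_append.2 ⟨s, hja, hjr⟩, hjc⟩⟩)
    _ < (payoffSum P (qa ++ qb ++ qc) (a ++ b' ++ c) : ℤ) := by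
        rw [WithTop.coe_lt_coe, payoffSum_append P (by simp; omega), payoffSum_append P hqa,
          payoffSum_append P (by simp; omega), payoffSum_append P hqa]
        omega
    _ = Mfun G P (a ++ b' ++ c) v w := hqM

theorem mem_walksDagger_of_append {a b c : List EH} (hne : b ≠ [])
    (h : a ++ b ++ c ∈ walksDagger G H P) : b ∈ walksDagger G H P := by
  obtain ⟨u, v, hp, -, hmax⟩ := h
  obtain ⟨-, -, hj⟩ := mem_walksFT_iff.1 hp
  obtain ⟨t, hj, hjc⟩ := joins_append.1 hj
  obtain ⟨s, hja, hjb⟩ := joins_append.1 hj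
  have hmem : b ∈ H.walksFT b.length s t := mem_walksFT_iff.2 ⟨rfl, hne, hjb⟩
  refine ⟨s, t, hmem, mem_image_of_mem _ hmem, ?_⟩
  rintro ⟨_, ⟨b', hb', rfl⟩, hdom⟩
  obtain ⟨hlen, hne', hjb'⟩ := mem_walksFT_iff.1 hb'
  exact hmax ⟨_, mem_image_of_mem _ (mem_walksFT_iff.2 ⟨by simp; omega, by simp [hne'],
    joins_append.2 ⟨t, joins_append.2 ⟨s, hja, hjb'⟩, hjc⟩⟩), strictDom_append hlen hdom⟩

end Payoff

theorem maxElems_strictDom_nonempty {V α : Type} [Nonempty V] [Preorder α]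
    {A : Set (V → V → α)} (hfin : A.Finite) (hne : A.Nonempty) :
    (maxElems StrictDom A).Nonempty := by
  have v : V := Classical.arbitrary V
  obtain ⟨f, hf, hmax⟩ := hfin.exists_maximalFor (fun f => f v v) A hne
  exact ⟨f, hf, fun ⟨g, hg, hlt⟩ => (hlt v v).not_ge (hmax hg (hlt v v).le)⟩

section Existence

variable {VG EG VH EH : Type} {G : DirGraph VG EG} {H : DirGraph VH EH}
  {P : EG → EH → ℤ}

theorem exists_seg_mem_walksDagger [Nonempty VG] [Finite EH] (hXH : (XEdge H).Nonempty)
    {m n : ℤ} (hmn : m ≤ n) : ∃ x : ℤ → EH, seg x m n ∈ walksDagger G H P := by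
  obtain ⟨z, hz⟩ := hXH
  obtain ⟨u, v, hj⟩ := exists_joins_seg hz m n
  have hmem : seg z m n ∈ H.walksFT (n + 1 - m).toNat u v :=
    mem_walksFT_iff.2 ⟨length_seg z m n, seg_ne_nil z hmn, hj⟩
  obtain ⟨_, ⟨p, hp, rfl⟩, hmax⟩ := maxElems_strictDom_nonempty
    ((H.finite_walksFT _ u v).image (Mfun G P)) ⟨_, mem_image_of_mem _ hmem⟩
  obtain ⟨hlen, hne, -⟩ := mem_walksFT_iff.1 hp
  obtain ⟨x, rfl⟩ := exists_seg_eq hne hlen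
  rw [← hlen] at hp hmax
  exact ⟨x, u, v, hp, mem_image_of_mem _ hp, hmax⟩

theorem exists_seg_mem_Rset [Finite EG] (hXG : (XEdge G).Nonempty) (x : ℤ → EH) {m n : ℤ}
    (hmn : m ≤ n) : ∃ y : ℤ → EG, seg y m n ∈ Rset G P (seg x m n) := by
  obtain ⟨z, hz⟩ := hXG
  obtain ⟨u, v, hj⟩ := exists_joins_seg hz m n
  obtain ⟨q, hq, hqM⟩ := exists_payoffSum_eq_Mfun (P := P) (p := seg x m n)
    ⟨seg z m n, mem_walksFT_iff.2 ⟨by simp [length_seg], seg_ne_nil z hmn, hj⟩⟩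
  obtain ⟨hlen, hne, -⟩ := mem_walksFT_iff.1 hq
  obtain ⟨y, rfl⟩ := exists_seg_eq hne (hlen.trans (length_seg x m n))
  exact ⟨y, u, v, hq, hqM⟩

theorem XHdag_nonempty [Finite EG] [Nonempty VG] [Finite EH] (hXH : (XEdge H).Nonempty) :
    (XHdag G H P).Nonempty := by
  obtain ⟨x, hx⟩ := exists_forall_seg_mem (fun _ _ => walksDagger G H P)
    (fun x m k l n hmk hkl hln h => mem_walksDagger_of_append (seg_ne_nil x hkl)
      (by rwa [← seg_append x hmk (by omega) hln]))
    (fun N => exists_seg_mem_walksDagger hXH (by omega))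
  refine ⟨x, mem_XEdge_of_joins_seg fun n => ?_, hx⟩
  obtain ⟨u, v, h, -⟩ := hx n (n + 1) (by omega)
  exact ⟨u, v, (mem_walksFT_iff.1 h).2.2⟩

theorem exists_mem_Ydag [Finite EG] (hXG : (XEdge G).Nonempty) {x : ℤ → EH}
    (hx : x ∈ XHdag G H P) : ∃ y ∈ XEdge G, (x, y) ∈ Ydag G H P := by
  obtain ⟨y, hy⟩ := exists_forall_seg_mem (fun m n => Rset G P (seg x m n))
    (fun y m k l n hmk hkl hln h => by
      rw [seg_append x hmk (by omega) hln, seg_append y hmk (by omega) hln] at h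
      exact mem_Rset_of_append (by simp [length_seg]) (by simp [length_seg])
        (seg_ne_nil y hkl) h)
    (fun N => exists_seg_mem_Rset hXG x (by omega))
  have hyE : y ∈ XEdge G := mem_XEdge_of_joins_seg fun n => by
    obtain ⟨u, v, h, -⟩ := hy n (n + 1) (by omega)
    exact ⟨u, v, (mem_walksFT_iff.1 h).2.2⟩
  exact ⟨y, hyE, hx, hyE, hy⟩

end Existence

/-- If `X_G` and `X_H` are nonempty, so are `X_H†` and `Y†_{(H,G)}`; moreover every
`x ∈ X_H†` extends to a pair `(x,y) ∈ Y†_{(H,G)}`. -/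
theorem XHdag_Ydag_nonempty {VG EG VH EH : Type} [Fintype VG] [Fintype EG]
    [Fintype VH] [Fintype EH] (G : DirGraph VG EG) (H : DirGraph VH EH)
    (P : EG → EH → ℤ) (hXG : (XEdge G).Nonempty) (hXH : (XEdge H).Nonempty) :
    (XHdag G H P).Nonempty ∧ (Ydag G H P).Nonempty ∧
      ∀ x ∈ XHdag G H P, ∃ y ∈ XEdge G, (x, y) ∈ Ydag G H P := by
  have : Nonempty VG := hXG.elim fun y _ => ⟨G.src (y 0)⟩
  have hlift : ∀ x ∈ XHdag G H P, ∃ y ∈ XEdge G, (x, y) ∈ Ydag G H P :=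
    fun x hx => exists_mem_Ydag hXG hx
  obtain ⟨x, hx⟩ : (XHdag G H P).Nonempty := XHdag_nonempty hXH
  obtain ⟨y, -, hxy⟩ := hlift x hx
  exact ⟨⟨x, hx⟩, ⟨(x, y), hxy⟩, hlift⟩
end
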